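/- The set N = {id, a, b, c, d} of functions on finite binary words is closed under restriction: for every g ∈ N and every finite binary word α, there exist h ∈ N and a finite binary word β with the same length as α such that g(α·w) = β·h(w) for every finite binary word w. -/

import Mathlib

/-- Generator `a` of the Grigorchuk group acting on finite binary words. -/
def grigA : List Bool → List Bool
  | [] => []
  | x :: w => (!x) :: w

mutual
  /-- Generator `b` of the Grigorchuk group acting on finite binary words. -/
  def grigB : List Bool → List Bool
    | [] => []
    | false :: w => false :: grigA w
    | true :: w => true :: grigC w
  /-- Generator `c` of the Grigorchuk group acting on finite binary words. -/
  def grigC : List Bool → List Bool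
    | [] => []
    | false :: w => false :: grigA w
    | true :: w => true :: grigD w
  /-- Generator `d` of the Grigorchuk group acting on finite binary words. -/
  def grigD : List Bool → List Bool
    | [] => []
    | false :: w => false :: w
    | true :: w => true :: grigB w
end

/-- Every member of the nucleus has a one-letter restriction in the nucleus. -/
theorem grig_nucleus_restrict_letter (g : List Bool → List Bool)
    (hg : g = id ∨ g = grigA ∨ g = grigB ∨ g = grigC ∨ g = grigD) (x : Bool) :
    ∃ h : List Bool → List Bool,
      (h = id ∨ h = grigA ∨ h = grigB ∨ h = grigC ∨ h = grigD) ∧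
      ∃ y : Bool, ∀ w : List Bool, g (x :: w) = y :: h w := by
  rcases hg with rfl | rfl | rfl | rfl | rfl
  · exact ⟨id, by simp, x, fun _ => rfl⟩
  · exact ⟨id, by simp, !x, fun _ => rfl⟩
  · cases x
    · exact ⟨grigA, by simp, false, fun w => by simp [grigB]⟩
    · exact ⟨grigC, by simp, true, fun w => by simp [grigB]⟩
  · cases x
    · exact ⟨grigA, by simp, false, fun w => by simp [grigC]⟩
    · exact ⟨grigD, by simp, true, fun w => by simp [grigC]⟩
  · cases x
    · exact ⟨id, by simp, false, fun w => by simp [grigD]⟩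
    · exact ⟨grigB, by simp, true, fun w => by simp [grigD]⟩

/-- The nucleus `{id, a, b, c, d}` of the Grigorchuk self-similar action is
closed under restriction: for each `g` in the nucleus and each finite word
`α`, there are `h` in the nucleus and a word `β` of the same length as
`α` such that `g(α·w) = β·h(w)` for every word `w`. -/
theorem grig_nucleus_closed_under_restriction
    (g : List Bool → List Bool)
    (hg : g = id ∨ g = grigA ∨ g = grigB ∨ g = grigC ∨ g = grigD)
    (α : List Bool) :
    ∃ h : List Bool → List Bool,
      (h = id ∨ h = grigA ∨ h = grigB ∨ h = grigC ∨ h = grigD) ∧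
      ∃ β : List Bool, β.length = α.length ∧
        ∀ w : List Bool, g (α ++ w) = β ++ h w := by
  induction α generalizing g with
  | nil => exact ⟨g, hg, [], rfl, fun w => rfl⟩
  | cons x α ih =>
    obtain ⟨k, hk, y, hy⟩ := grig_nucleus_restrict_letter g hg x
    obtain ⟨h, hh, β, hβ, hw⟩ := ih k hk
    exact ⟨h, hh, y :: β, by simp [hβ], fun w => by simp [hy, hw]⟩
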